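/- arXiv:2209.10322 — 2 statements merged into one kernel-verified Lean document; each statement's English description precedes it below -/
import Mathlib

section
/- Correctness of the reduction from QBF to the Non-Emptiness problem for the strategy semantics: let Φ = Q₁x₁ … Q_nx_n ψ be a quantified Boolean formula with Q_i ∈ {∃, ∀} and ψ = C₁ ∧ … ∧ C_k in conjunctive normal form over x₁,…,x_n. Build the turn-based game arena A_Φ over Prop = {Start, p₁,…,p_k} with positions {Start} ∪ {v_i, ¬v_i : 1 ≤ i ≤ n}: at the position where variable x_i is chosen (Start for i = 1, and v_{i-1} or ¬v_{i-1} for i ≥ 2), the move is made by Attacker if Q_i = ∃ and by Defender if Q_i = ∀, with action True leading to v_i and action False leading to ¬v_i; positions v_n and ¬v_n carry self-loops. The valuation is λ(Start) = {Start}, λ(v_i) = {p_j : x_i ∈ C_j} and λ(¬v_i) = {p_j : ¬x_i ∈ C_j}. Then Φ is true if and only if the strategy semantics [[SAND(Start, AND(p₁,…,p_k))]]^strat over A_Φ is nonempty. -/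
/-! ### Words, merge, synchronized concatenation, s-trees -/

/-- The merge of two sets of words:
`P ⋈ Q = {p ∈ P : ∃ q ∈ Q, q ≼ p} ∪ {q ∈ Q : ∃ p ∈ P, p ≼ q}`. -/
def merge {α : Type*} (P Q : Set (List α)) : Set (List α) :=
  {p | p ∈ P ∧ ∃ q ∈ Q, q <+: p} ∪ {q | q ∈ Q ∧ ∃ p ∈ P, p <+: q}

/-- Synchronized concatenation, lifted to sets of words: `π ⊙ π'` is defined when the
last letter of `π` equals the first letter of `π'` and concatenates `π` with the tail of `π'`. -/
def sconcat {α : Type*} (P Q : Set (List α)) : Set (List α) :=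
  {w | ∃ p ∈ P, ∃ q ∈ Q, p.getLast? = q.head? ∧ w = p ++ q.tail}

/-- An s-tree over an alphabet `α`: a nonempty set of nonempty words, closed under
nonempty prefixes, all words having the same first letter (the root). -/
def IsSTree {α : Type*} (S : Set (List α)) : Prop :=
  S.Nonempty ∧ (∀ w ∈ S, w ≠ []) ∧
  (∀ w ∈ S, ∀ w' : List α, w' <+: w → w' ≠ [] → w' ∈ S) ∧
  (∃ a, ∀ w ∈ S, w.head? = some a)

/-- A leaf of an s-tree: a word with no proper extension in the tree. -/
def IsLeafOf {α : Type*} (S : Set (List α)) (w : List α) : Prop :=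
  w ∈ S ∧ ∀ w' ∈ S, w <+: w' → w' = w

/-- The children of `w` in `S`: its minimal proper extensions in `S`. -/
def childrenOf {α : Type*} (S : Set (List α)) (w : List α) : Set (List α) :=
  {w' | w' ∈ S ∧ w <+: w' ∧ w' ≠ w ∧
    ∀ w'' ∈ S, w <+: w'' → w'' <+: w' → w'' = w ∨ w'' = w'}

/-- `S'` is a prefix of the s-tree `S`: `S'` is an s-tree with the same root,
`S' ⊆ S`, and every non-leaf of `S'` has the same children in `S'` as in `S`. -/
def TreePrefix {α : Type*} (S' S : Set (List α)) : Prop :=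
  IsSTree S' ∧ (∃ a, [a] ∈ S' ∧ [a] ∈ S) ∧ S' ⊆ S ∧
  ∀ w ∈ S', ¬ IsLeafOf S' w → childrenOf S' w = childrenOf S w

/-! ### Transition systems and attack trees -/

/-- A transition system over propositions `π` with states `σ`. -/
structure TSys (σ π : Type*) where
  step : σ → σ → Prop
  val : σ → Set π

/-- A path of a transition system: a nonempty finite sequence of states related by `step`. -/
def IsTPath {σ π : Type*} (T : TSys σ π) (w : List σ) : Prop :=
  w ≠ [] ∧ List.Chain' T.step w

/-- Attack trees: a leaf is a Boolean formula, identified with the set of states where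
it holds; inner nodes are `OR`, `SAND` and `AND` operators. -/
inductive ATree (σ : Type*) where
  | leaf (F : Set σ)
  | or (t₁ t₂ : ATree σ)
  | sand (t₁ t₂ : ATree σ)
  | and (t₁ t₂ : ATree σ)

/-- The number of leaves of an attack tree. -/
def numLeaves {σ : Type*} : ATree σ → ℕ
  | .leaf _ => 1
  | .or t₁ t₂ => numLeaves t₁ + numLeaves t₂
  | .sand t₁ t₂ => numLeaves t₁ + numLeaves t₂
  | .and t₁ t₂ => numLeaves t₁ + numLeaves t₂

/-- The path semantics of an attack tree over a transition system. -/
def pathSem {σ π : Type*} (T : TSys σ π) : ATree σ → Set (List σ)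
  | .leaf F => {w | IsTPath T w ∧ ∃ s ∈ F, w.getLast? = some s}
  | .or t₁ t₂ => pathSem T t₁ ∪ pathSem T t₂
  | .sand t₁ t₂ => sconcat (pathSem T t₁) (pathSem T t₂)
  | .and t₁ t₂ => merge (pathSem T t₁) (pathSem T t₂)

/-! ### Two-player game arenas -/

/-- A two-player concurrent game arena: a total transition function on positions given
joint actions of the two players, and a valuation of positions by atomic propositions. -/
structure Arena (Pos Act₁ Act₂ Prp : Type*) where
  delta : Pos → Act₁ × Act₂ → Pos
  val : Pos → Set Prp

variable {Pos Act₁ Act₂ Prp : Type*}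

/-- A play: an infinite sequence of positions, each next one reached by some joint action. -/
def IsPlay (A : Arena Pos Act₁ Act₂ Prp) (ρ : ℕ → Pos) : Prop :=
  ∀ i : ℕ, ∃ a : Act₁ × Act₂, ρ (i + 1) = A.delta (ρ i) a

/-- The prefix of length `n` of a play. -/
def playPrefix (ρ : ℕ → Pos) (n : ℕ) : List Pos :=
  (List.range n).map ρ

/-- Consistency of a history with a strategy `σ` of the player whose actions are extracted
from joint actions by `proj` (`Prod.fst` for Player 1/Attacker, `Prod.snd` for Player 2). -/
def ConsistHist {Act : Type*} (A : Arena Pos Act₁ Act₂ Prp) (proj : Act₁ × Act₂ → Act)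
    (σ : List Pos → Act) (w : List Pos) : Prop :=
  ∀ (j : ℕ) (h : j + 1 < w.length),
    ∃ a : Act₁ × Act₂,
      A.delta (w[j]'(Nat.lt_of_succ_lt h)) a = w[j + 1]'h ∧ proj a = σ (w.take (j + 1))

/-- A play is consistent with a strategy if all its nonempty finite prefixes are. -/
def ConsistPlay {Act : Type*} (A : Arena Pos Act₁ Act₂ Prp) (proj : Act₁ × Act₂ → Act)
    (σ : List Pos → Act) (ρ : ℕ → Pos) : Prop :=
  ∀ n : ℕ, ConsistHist A proj σ (playPrefix ρ n)

/-- A history: a nonempty finite prefix of a play. -/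
def IsHist (A : Arena Pos Act₁ Act₂ Prp) (w : List Pos) : Prop :=
  ∃ ρ, IsPlay A ρ ∧ ∃ n, 1 ≤ n ∧ w = playPrefix ρ n

/-- `Hist A v`: the histories starting at position `v`. -/
def Hist (A : Arena Pos Act₁ Act₂ Prp) (v : Pos) : Set (List Pos) :=
  {w | ∃ ρ, IsPlay A ρ ∧ ρ 0 = v ∧ ∃ n, 1 ≤ n ∧ w = playPrefix ρ n}

/-- `Prefixes(Out(σ))`: nonempty finite prefixes of plays consistent with `σ`. -/
def PrefixesOut {Act : Type*} (A : Arena Pos Act₁ Act₂ Prp) (proj : Act₁ × Act₂ → Act)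
    (σ : List Pos → Act) : Set (List Pos) :=
  {w | ∃ ρ, IsPlay A ρ ∧ ConsistPlay A proj σ ρ ∧ ∃ n, 1 ≤ n ∧ w = playPrefix ρ n}

/-- The s-tree associated with a strategy `σ` from position `v`:
`S^σ_v = Prefixes(Out(σ)) ∩ Hist(A, v)`. -/
def STree {Act : Type*} (A : Arena Pos Act₁ Act₂ Prp) (proj : Act₁ × Act₂ → Act)
    (σ : List Pos → Act) (v : Pos) : Set (List Pos) :=
  PrefixesOut A proj σ ∩ Hist A v

/-- The transition system induced by a game arena: `(v, v')` is a transition iff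
`δ(v, a) = v'` for some joint action `a`. -/
def arenaTS (A : Arena Pos Act₁ Act₂ Prp) : TSys Pos Prp :=
  ⟨fun v v' => ∃ a : Act₁ × Act₂, A.delta v a = v', A.val⟩

/-- An Attacker strategy is winning for the reachability game `(A, R)` from `v` if every
play consistent with it starting at `v` visits a position of `R`. -/
def WinningFrom (A : Arena Pos Act₁ Act₂ Prp) (σ : List Pos → Act₁) (v : Pos)
    (R : Set Pos) : Prop :=
  ∀ ρ : ℕ → Pos, IsPlay A ρ → ConsistPlay A Prod.fst σ ρ → ρ 0 = v → ∃ i, ρ i ∈ R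

/-- A witness of an Attacker strategy `σ` from `v` for the reachability set `R`:
a finite prefix of `S^σ_v` all of whose leaves end in a position of `R`. -/
def Witness (A : Arena Pos Act₁ Act₂ Prp) (σ : List Pos → Act₁) (v : Pos) (R : Set Pos)
    (S : Set (List Pos)) : Prop :=
  S.Finite ∧ TreePrefix S (STree A Prod.fst σ v) ∧
  ∀ w, IsLeafOf S w → ∃ p ∈ R, w.getLast? = some p

/-- An s-tree over `Pos` is well-formed if it is a prefix of `S^σ_v` for some Attacker
strategy `σ` and position `v`. -/
def WellFormed (A : Arena Pos Act₁ Act₂ Prp) (S : Set (List Pos)) : Prop :=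
  ∃ (σ : List Pos → Act₁) (v : Pos), TreePrefix S (STree A Prod.fst σ v)

/-- The strategy semantics of an attack tree `t` over the arena `A`: the set of all
well-formed `t`-s-trees, i.e. well-formed finite s-trees all of whose leaves belong to
the path semantics of `t` over the transition system induced by `A`. -/
def stratSem (A : Arena Pos Act₁ Act₂ Prp) (t : ATree Pos) : Set (Set (List Pos)) :=
  {S | WellFormed A S ∧ S.Finite ∧ IsSTree S ∧
    ∀ w, IsLeafOf S w → w ∈ pathSem (arenaTS A) t}

/-! ### The QBF / SAT reduction constructions -/

/-- Truth of a quantified Boolean formula `Q₁x₁ … Q_nx_n ψ`: `Q i = true` means `∃`,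
`Q i = false` means `∀`; `sat` is the matrix, as a predicate on assignments. -/
def qbfTrue : (n : ℕ) → (Fin n → Bool) → ((Fin n → Bool) → Prop) → Prop
  | 0, _, sat => sat (fun i => i.elim0)
  | _ + 1, Q, sat =>
    if Q 0 then
      ∃ b : Bool, qbfTrue _ (fun i => Q i.succ) (fun α => sat (Fin.cons b α))
    else
      ∀ b : Bool, qbfTrue _ (fun i => Q i.succ) (fun α => sat (Fin.cons b α))

/-- Positions of the reduction arena: `none` is `Start`; `some (i, true)` is `v_i` and
`some (i, false)` is `¬v_i`. -/
abbrev QPos (n : ℕ) := Option (Fin (n + 1) × Bool)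

/-- The turn-based transition function of the reduction arena: at the position choosing
variable `x_i`, the value of `x_i` is the action of Attacker if `Q i = true` (`∃`) and of
Defender otherwise (`∀`); action `true` leads to `v_i`, action `false` to `¬v_i`; the
final positions `v_n`, `¬v_n` carry self-loops. -/
def qDelta (n : ℕ) (Q : Fin (n + 1) → Bool) : QPos n → Bool × Bool → QPos n
  | none, a => some (0, if Q 0 then a.1 else a.2)
  | some (i, b), a =>
    if h : (i : ℕ) + 1 < n + 1 then
      some (⟨(i : ℕ) + 1, h⟩, if Q ⟨(i : ℕ) + 1, h⟩ then a.1 else a.2)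
    else some (i, b)

/-- The valuation of the reduction arena over `Prop = {Start, p₁, …, p_k}` (`none` is
`Start`, `some j` is `p_j`): `λ(Start) = {Start}`, `p_j` holds at `v_i` iff `x_i ∈ C_j`
and at `¬v_i` iff `¬x_i ∈ C_j`, where `C j (i, b)` means that the literal `x_i` (if `b`)
or `¬x_i` (if `¬b`) occurs in clause `C_j`. -/
def qVal (n k : ℕ) (C : Fin (k + 1) → Fin (n + 1) × Bool → Prop) :
    QPos n → Set (Option (Fin (k + 1)))
  | none => {none}
  | some (i, b) => {x | ∃ j, x = some j ∧ C j (i, b)}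

/-- The reduction arena `A_Φ`. -/
def qArena (n k : ℕ) (Q : Fin (n + 1) → Bool)
    (C : Fin (k + 1) → Fin (n + 1) × Bool → Prop) :
    Arena (QPos n) Bool Bool (Option (Fin (k + 1))) :=
  ⟨qDelta n Q, qVal n k C⟩

/-- The attack tree `SAND(Start, AND(p₁, …, p_k))`, each leaf formula being identified
with the set of positions where it holds. -/
def qTree (n k : ℕ) (C : Fin (k + 1) → Fin (n + 1) × Bool → Prop) : ATree (QPos n) :=
  ATree.sand (ATree.leaf {v | none ∈ qVal n k C v})
    ((List.ofFn (fun j : Fin k => ATree.leaf {v | some j.castSucc ∈ qVal n k C v})).foldr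
      ATree.and (ATree.leaf {v | some (Fin.last k) ∈ qVal n k C v}))

/-! ### Prefixes of plays -/

@[simp] theorem length_playPrefix (ρ : ℕ → Pos) (m : ℕ) : (playPrefix ρ m).length = m := by
  simp [playPrefix]

@[simp] theorem getElem_playPrefix (ρ : ℕ → Pos) (m j : ℕ) (h : j < (playPrefix ρ m).length) :
    (playPrefix ρ m)[j] = ρ j := by
  simp [playPrefix]

theorem mem_playPrefix {ρ : ℕ → Pos} {m : ℕ} {v : Pos} :
    v ∈ playPrefix ρ m ↔ ∃ i < m, ρ i = v := by
  simp [playPrefix]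

theorem playPrefix_succ (ρ : ℕ → Pos) (m : ℕ) :
    playPrefix ρ (m + 1) = playPrefix ρ m ++ [ρ m] := by
  simp [playPrefix, List.range_succ]

theorem head?_playPrefix (ρ : ℕ → Pos) {m : ℕ} (hm : 1 ≤ m) :
    (playPrefix ρ m).head? = some (ρ 0) := by
  obtain ⟨m, rfl⟩ := Nat.exists_eq_add_of_le' hm
  simp [playPrefix, List.range_succ_eq_map]

theorem take_playPrefix (ρ : ℕ → Pos) {l m : ℕ} (h : l ≤ m) :
    (playPrefix ρ m).take l = playPrefix ρ l := by
  simp [playPrefix, ← List.map_take, List.take_range, h]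

theorem playPrefix_isPrefix (ρ : ℕ → Pos) {l m : ℕ} (h : l ≤ m) :
    playPrefix ρ l <+: playPrefix ρ m := by
  rw [← take_playPrefix ρ h]
  exact List.take_prefix _ _

theorem eq_playPrefix_of_isPrefix {ρ : ℕ → Pos} {m : ℕ} {w : List Pos}
    (h : w <+: playPrefix ρ m) : w = playPrefix ρ w.length := by
  have hl : w.length ≤ m := by simpa using h.length_le
  rw [← take_playPrefix ρ hl]
  exact List.prefix_iff_eq_take.mp h

theorem isTPath_playPrefix {A : Arena Pos Act₁ Act₂ Prp} {ρ : ℕ → Pos} (hρ : IsPlay A ρ)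
    {m : ℕ} (hm : 1 ≤ m) : IsTPath (arenaTS A) (playPrefix ρ m) := by
  refine ⟨fun h => ?_, ?_⟩
  · have := congrArg List.length h
    simp at this
    omega
  · refine List.isChain_iff_getElem.mpr fun i hi => ?_
    obtain ⟨a, ha⟩ := hρ i
    exact ⟨a, by simpa using ha.symm⟩

/-- Against a constant Defender, every Attacker strategy has a consistent play. -/
theorem exists_consistPlay (A : Arena Pos Act₁ Act₂ Prp) (σ : List Pos → Act₁) (d : Act₂)
    (v : Pos) : ∃ ρ, IsPlay A ρ ∧ ConsistPlay A Prod.fst σ ρ ∧ ρ 0 = v := by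
  let next : List Pos × Pos → List Pos × Pos := fun x =>
    (x.1 ++ [A.delta x.2 (σ x.1, d)], A.delta x.2 (σ x.1, d))
  let run : ℕ → List Pos × Pos := fun i => next^[i] ([v], v)
  have hrun : ∀ i, run (i + 1) = next (run i) := fun i => Function.iterate_succ_apply' _ _ _
  have hpre : ∀ i, (run i).1 = playPrefix (fun i => (run i).2) (i + 1) := by
    intro i
    induction i with
    | zero => rfl
    | succ i ih => rw [playPrefix_succ, ← ih, hrun]
  refine ⟨fun i => (run i).2, fun i => ⟨(σ (run i).1, d), by simp only [hrun, next]⟩, fun m j hj => ?_, rfl⟩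
  rw [length_playPrefix] at hj
  rw [take_playPrefix _ (by omega), ← hpre]
  exact ⟨(σ (run j).1, d), by simp only [getElem_playPrefix]; rw [hrun], rfl⟩

theorem IsSTree.exists_isLeafOf {α : Type*} {S : Set (List α)} (hS : IsSTree S)
    (hfin : S.Finite) : ∃ w, IsLeafOf S w := by
  obtain ⟨w, hw, hmax⟩ := Set.exists_max_image S List.length hfin hS.1
  exact ⟨w, hw, fun w' hw' h => (h.eq_of_length_le (hmax w' hw')).symm⟩

/-! ### Path semantics of a conjunction of leaves -/

theorem exists_prefix_getLast?_of_mem {α : Type*} {w : List α} {s : α} (h : s ∈ w) :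
    ∃ p, p <+: w ∧ p.getLast? = some s := by
  obtain ⟨l₁, l₂, rfl⟩ := List.append_of_mem h
  exact ⟨l₁ ++ [s], ⟨l₂, by simp⟩, by simp⟩

/-- A shortest prefix of `w` meeting all the sets of a nonempty list ends in one of them. -/
theorem exists_prefix_meeting {α : Type*} {L : List (Set α)} (hL : L ≠ []) (w : List α)
    (hw : ∀ F ∈ L, ∃ s ∈ w, s ∈ F) :
    ∃ p, p <+: w ∧ (∀ F ∈ L, ∃ s ∈ p, s ∈ F) ∧ ∃ F ∈ L, ∃ s ∈ F, p.getLast? = some s := by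
  induction w using List.reverseRecOn with
  | nil =>
    obtain ⟨F, hF⟩ := List.exists_mem_of_ne_nil _ hL
    simpa using hw F hF
  | append_singleton u a ih =>
    by_cases hu : ∀ F ∈ L, ∃ s ∈ u, s ∈ F
    · obtain ⟨p, hp, h⟩ := ih hu
      exact ⟨p, hp.trans (List.prefix_append _ _), h⟩
    · push Not at hu
      obtain ⟨F, hF, hn⟩ := hu
      obtain ⟨s, hs, hsF⟩ := hw F hF
      refine ⟨_, List.prefix_rfl, hw, F, hF, s, hsF, ?_⟩
      rcases List.mem_append.mp hs with h | h
      · exact absurd hsF (hn s h)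
      · simp_all

theorem IsTPath.of_isPrefix {σ π : Type*} {T : TSys σ π} {p w : List σ} (hw : IsTPath T w)
    (h : p <+: w) (hp : p ≠ []) : IsTPath T p :=
  ⟨hp, List.IsChain.prefix hw.2 h⟩

theorem mem_pathSem_foldr_and {σ π : Type*} (T : TSys σ π) (F₀ : Set σ) (L : List (Set σ))
    (w : List σ) :
    w ∈ pathSem T ((L.map ATree.leaf).foldr ATree.and (ATree.leaf F₀)) ↔
      IsTPath T w ∧ (∃ F ∈ F₀ :: L, ∃ s ∈ F, w.getLast? = some s) ∧
        ∀ F ∈ F₀ :: L, ∃ s ∈ w, s ∈ F := by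
  induction L generalizing w with
  | nil =>
    simp only [List.map_nil, List.foldr_nil, pathSem, Set.mem_ofPred_eq, List.mem_singleton,
      exists_eq_left, forall_eq]
    constructor
    · rintro ⟨h, s, hs, hl⟩
      exact ⟨h, ⟨s, hs, hl⟩, s, List.mem_of_getLast? hl, hs⟩
    · rintro ⟨h, h', -⟩
      exact ⟨h, h'⟩
  | cons G L ih =>
    simp only [List.map_cons, List.foldr_cons, pathSem, merge, Set.mem_union, Set.mem_ofPred_eq, ih]
    constructor
    · rintro (⟨⟨hw, s, hs, hl⟩, q, ⟨-, -, hq⟩, hqw⟩ | ⟨⟨hw, ⟨F, hF, hl⟩, hall⟩, p, ⟨-, s, hs, hl'⟩, hpw⟩)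
      · refine ⟨hw, ⟨G, by simp, s, hs, hl⟩, fun F hF => ?_⟩
        by_cases hFG : F = G
        · exact ⟨s, List.mem_of_getLast? hl, hFG ▸ hs⟩
        · obtain ⟨t, ht, htF⟩ := hq F (by simp_all)
          exact ⟨t, hqw.subset ht, htF⟩
      · refine ⟨hw, ⟨F, by simp at hF ⊢; tauto, hl⟩, fun F' hF' => ?_⟩
        by_cases hFG : F' = G
        · exact ⟨s, hpw.subset (List.mem_of_getLast? hl'), hFG ▸ hs⟩
        · exact hall F' (by simp_all)
    · rintro ⟨hw, ⟨F, hF, hl⟩, hall⟩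
      have hall' : ∀ F ∈ F₀ :: L, ∃ s ∈ w, s ∈ F := fun F hF => hall F (by simp at hF ⊢; tauto)
      by_cases hFG : F = G
      · subst hFG
        obtain ⟨q, hqw, hq, hql⟩ := exists_prefix_meeting (by simp) w hall'
        refine Or.inl ⟨⟨hw, hl⟩, q, ⟨hw.of_isPrefix hqw ?_, hql, hq⟩, hqw⟩
        rintro rfl
        simp at hql
      · obtain ⟨s, hs, hsG⟩ := hall G (by simp)
        obtain ⟨p, hpw, hpl⟩ := exists_prefix_getLast?_of_mem hs
        refine Or.inr ⟨⟨hw, ⟨F, by simp_all, hl⟩, hall'⟩, p, ⟨hw.of_isPrefix hpw ?_, s, hsG, hpl⟩, hpw⟩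
        rintro rfl
        simp at hpl

/-- A word meets every clause: each `p_j` holds at some position of the word. -/
def MeetsAll (n k : ℕ) (C : Fin (k + 1) → Fin (n + 1) × Bool → Prop) (w : List (QPos n)) : Prop :=
  ∀ j : Fin (k + 1), ∃ s ∈ w, some j ∈ qVal n k C s

theorem MeetsAll.mono {n k : ℕ} {C : Fin (k + 1) → Fin (n + 1) × Bool → Prop}
    {u w : List (QPos n)} (h : MeetsAll n k C u) (huw : u ⊆ w) : MeetsAll n k C w := fun j =>
  let ⟨s, hs, hj⟩ := h j
  ⟨s, huw hs, hj⟩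

theorem not_meetsAll_start (n k : ℕ) (C : Fin (k + 1) → Fin (n + 1) × Bool → Prop) :
    ¬ MeetsAll n k C [none] := by
  intro h
  obtain ⟨s, hs, hj⟩ := h 0
  simp_all [qVal]

theorem none_mem_qVal {n k : ℕ} {C : Fin (k + 1) → Fin (n + 1) × Bool → Prop} {v : QPos n} :
    none ∈ qVal n k C v ↔ v = none := by
  rcases v with _ | ⟨i, b⟩ <;> simp [qVal]

theorem some_mem_qVal_some {n k : ℕ} {C : Fin (k + 1) → Fin (n + 1) × Bool → Prop}
    {j : Fin (k + 1)} {x : Fin (n + 1) × Bool} :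
    some j ∈ qVal n k C (some x) ↔ C j x := by
  simp [qVal]

theorem mem_pathSem_and_clauses {n k : ℕ} {π : Type*} (T : TSys (QPos n) π)
    (C : Fin (k + 1) → Fin (n + 1) × Bool → Prop) (w : List (QPos n)) :
    w ∈ pathSem T
        ((List.ofFn (fun j : Fin k => ATree.leaf {v | some j.castSucc ∈ qVal n k C v})).foldr
          ATree.and (ATree.leaf {v | some (Fin.last k) ∈ qVal n k C v})) ↔
      IsTPath T w ∧ (∃ j, ∃ s, some j ∈ qVal n k C s ∧ w.getLast? = some s) ∧
        MeetsAll n k C w := by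
  have h := mem_pathSem_foldr_and T {v | some (Fin.last k) ∈ qVal n k C v}
    (List.ofFn (fun j : Fin k => {v | some j.castSucc ∈ qVal n k C v})) w
  rw [List.map_ofFn] at h
  refine h.trans ?_
  simp only [List.mem_cons, List.mem_ofFn, MeetsAll, Fin.exists_fin_succ', Fin.forall_fin_succ',
    exists_eq_or_imp, forall_eq_or_imp, forall_exists_index, forall_apply_eq_imp_iff,
    Set.mem_ofPred_eq, exists_exists_eq_and]
  rw [or_comm, and_comm (b := ∀ _, _)]

theorem mem_pathSem_qTree_of_meetsAll {n k : ℕ} {π : Type*} {T : TSys (QPos n) π}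
    {C : Fin (k + 1) → Fin (n + 1) × Bool → Prop} {w : List (QPos n)} (hw : IsTPath T w)
    (hhead : w.head? = some none) (hlast : ∃ j, ∃ s, some j ∈ qVal n k C s ∧ w.getLast? = some s)
    (hmeet : MeetsAll n k C w) : w ∈ pathSem T (qTree n k C) := by
  refine ⟨[none], ⟨⟨by simp, List.isChain_singleton _⟩, none, by simp [qVal], by simp⟩, w,
    (mem_pathSem_and_clauses T C w).mpr ⟨hw, hlast, hmeet⟩, by simp [hhead], ?_⟩
  cases w <;> simp_all

theorem meetsAll_of_mem_pathSem_qTree {n k : ℕ} {π : Type*} {T : TSys (QPos n) π}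
    {C : Fin (k + 1) → Fin (n + 1) × Bool → Prop} {w : List (QPos n)}
    (h : w ∈ pathSem T (qTree n k C)) : none ∈ w ∧ MeetsAll n k C w := by
  obtain ⟨p, ⟨-, s, hs, hps⟩, q, hq, hpq, rfl⟩ := h
  obtain rfl := none_mem_qVal.mp hs
  have hmem : none ∈ p := List.mem_of_getLast? hps
  refine ⟨by simp [hmem], ((mem_pathSem_and_clauses T C q).mp hq).2.2.mono fun t ht => ?_⟩
  rcases q with _ | ⟨a, q⟩
  · simp at ht
  · rw [hps] at hpq
    obtain rfl : none = a := by simpa using hpq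
    rcases List.mem_cons.mp ht with rfl | ht
    · exact List.mem_append_left _ hmem
    · exact List.mem_append_right _ ht

/-! ### Plays of the reduction arena -/

/-- The play of the reduction arena in which the players choose the assignment `α`. -/
def assignPlay {n : ℕ} (α : Fin (n + 1) → Bool) : ℕ → QPos n
  | 0 => none
  | i + 1 => some (⟨min i n, by omega⟩, α ⟨min i n, by omega⟩)

theorem assignPlay_succ {n : ℕ} (α : Fin (n + 1) → Bool) (i : Fin (n + 1)) :
    assignPlay α (i + 1) = some (i, α i) := by
  have : min (i : ℕ) n = i := by omega
  simp [assignPlay, this]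

theorem qDelta_assignPlay {n : ℕ} (Q : Fin (n + 1) → Bool) (α : Fin (n + 1) → Bool) (i : Fin (n + 1))
    (a : Bool × Bool) :
    qDelta n Q (assignPlay α i) a = some (i, if Q i then a.1 else a.2) := by
  obtain ⟨i, hi⟩ := i
  cases i with
  | zero => rfl
  | succ i =>
    have := assignPlay_succ α ⟨i, by omega⟩
    dsimp only at this ⊢
    rw [this]
    simp [qDelta, Nat.lt_of_succ_lt_succ hi]

theorem qDelta_assignPlay_of_lt {n : ℕ} (Q : Fin (n + 1) → Bool) (α : Fin (n + 1) → Bool) {i : ℕ}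
    (hi : n < i) (a : Bool × Bool) :
    qDelta n Q (assignPlay α i) a = assignPlay α (i + 1) := by
  obtain ⟨i, rfl⟩ := Nat.exists_eq_add_of_lt hi
  have h : min (n + i + 1) n = n := by omega
  simp [qDelta, assignPlay, h]

theorem qDelta_ne_none {n : ℕ} (Q : Fin (n + 1) → Bool) (v : QPos n) (a : Bool × Bool) :
    qDelta n Q v a ≠ none := by
  rcases v with _ | ⟨i, b⟩
  · simp [qDelta]
  · by_cases h : (i : ℕ) + 1 < n + 1 <;> simp [qDelta, h]

section

variable {n k : ℕ} {Q : Fin (n + 1) → Bool} {C : Fin (k + 1) → Fin (n + 1) × Bool → Prop}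

theorem isPlay_assignPlay (α : Fin (n + 1) → Bool) : IsPlay (qArena n k Q C) (assignPlay α) := by
  intro i
  by_cases hi : i < n + 1
  · refine ⟨(α ⟨i, hi⟩, α ⟨i, hi⟩), ?_⟩
    have := qDelta_assignPlay Q α ⟨i, hi⟩ (α ⟨i, hi⟩, α ⟨i, hi⟩)
    simp only [ite_self] at this
    exact (assignPlay_succ α ⟨i, hi⟩).trans this.symm
  · exact ⟨(true, true), (qDelta_assignPlay_of_lt Q α (by omega) _).symm⟩

theorem IsPlay.exists_eq_assignPlay {ρ : ℕ → QPos n} (hρ : IsPlay (qArena n k Q C) ρ)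
    (h0 : ρ 0 = none) : ∃ α, ρ = assignPlay α := by
  refine ⟨fun i => ((ρ (i + 1)).map Prod.snd).getD false, funext fun i => ?_⟩
  induction i with
  | zero => exact h0
  | succ i ih =>
    obtain ⟨a, ha⟩ := hρ i
    change _ = qDelta n Q (ρ i) a at ha
    rw [ih] at ha
    by_cases hi : i < n + 1
    · have h₁ := qDelta_assignPlay Q (fun i => ((ρ (i + 1)).map Prod.snd).getD false) ⟨i, hi⟩ a
      have h₂ := assignPlay_succ (fun i => ((ρ (i + 1)).map Prod.snd).getD false) ⟨i, hi⟩
      dsimp only at h₁ h₂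
      rw [h₁] at ha
      rw [h₂, ha]
      rfl
    · rw [ha, qDelta_assignPlay_of_lt Q _ (by omega)]

theorem IsPlay.zero_eq_none {ρ : ℕ → QPos n} (hρ : IsPlay (qArena n k Q C) ρ) {i : ℕ}
    (hi : ρ i = none) : ρ 0 = none := by
  cases i with
  | zero => exact hi
  | succ i =>
    obtain ⟨a, ha⟩ := hρ i
    exact absurd (ha.symm.trans hi) (qDelta_ne_none Q _ a)

theorem consistPlay_assignPlay_iff {σ : List (QPos n) → Bool} {α : Fin (n + 1) → Bool} :
    ConsistPlay (qArena n k Q C) Prod.fst σ (assignPlay α) ↔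
      ∀ i : Fin (n + 1), Q i = true → α i = σ (playPrefix (assignPlay α) (i + 1)) := by
  constructor
  · intro h i hQ
    obtain ⟨a, ha, hσ⟩ := h (i + 2) i (by simp)
    rw [take_playPrefix _ (by omega)] at hσ
    simp only [getElem_playPrefix] at ha
    have := (qDelta_assignPlay Q α i a).symm.trans (ha.trans (assignPlay_succ α i))
    simp only [hQ, if_true, Option.some.injEq, Prod.mk.injEq, true_and] at this
    rw [← this, hσ]
  · intro h m j hj
    simp only [length_playPrefix] at hj
    rw [take_playPrefix _ (by omega)]
    simp only [getElem_playPrefix]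
    by_cases hjn : j < n + 1
    · refine ⟨(σ (playPrefix (assignPlay α) (j + 1)), α ⟨j, hjn⟩), ?_, rfl⟩
      refine (qDelta_assignPlay Q α ⟨j, hjn⟩ _).trans
        (Eq.trans ?_ (assignPlay_succ α ⟨j, hjn⟩).symm)
      by_cases hQ : Q ⟨j, hjn⟩ = true
      · simp [hQ, h _ hQ]
      · simp [hQ]
    · exact ⟨(_, true), qDelta_assignPlay_of_lt Q α (by omega) _, rfl⟩

theorem mem_sTree_start_iff {σ : List (QPos n) → Bool} {w : List (QPos n)} :
    w ∈ STree (qArena n k Q C) Prod.fst σ none ↔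
      ∃ α, ConsistPlay (qArena n k Q C) Prod.fst σ (assignPlay α) ∧
        ∃ m, 1 ≤ m ∧ w = playPrefix (assignPlay α) m := by
  constructor
  · rintro ⟨⟨ρ, hρ, hc, m, hm, rfl⟩, ρ', -, h0, m', hm', he⟩
    have := (head?_playPrefix ρ hm).symm.trans ((congrArg List.head? he).trans
      (head?_playPrefix ρ' hm'))
    obtain ⟨α, rfl⟩ := hρ.exists_eq_assignPlay ((Option.some.inj this).trans h0)
    exact ⟨α, hc, m, hm, rfl⟩
  · rintro ⟨α, hc, m, hm, rfl⟩
    exact ⟨⟨_, isPlay_assignPlay α, hc, m, hm, rfl⟩, _, isPlay_assignPlay α, rfl, m, hm, rfl⟩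

theorem meetsAll_playPrefix {α : Fin (n + 1) → Bool} (h : ∀ j, ∃ i, C j (i, α i)) :
    MeetsAll n k C (playPrefix (assignPlay α) (n + 2)) := fun j =>
  let ⟨i, hi⟩ := h j
  ⟨_, mem_playPrefix.mpr ⟨i + 1, by omega, assignPlay_succ α i⟩, some_mem_qVal_some.mpr hi⟩

theorem satisfies_of_meetsAll_playPrefix {α : Fin (n + 1) → Bool} {m : ℕ}
    (h : MeetsAll n k C (playPrefix (assignPlay α) m)) (j : Fin (k + 1)) : ∃ i, C j (i, α i) := by
  obtain ⟨s, hs, hj⟩ := h j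
  obtain ⟨i, hi, rfl⟩ := mem_playPrefix.mp hs
  cases i with
  | zero => simp [assignPlay, qVal] at hj
  | succ i => exact ⟨_, some_mem_qVal_some.mp hj⟩

/-! ### From strategies to s-trees and back -/

/-- If every play consistent with `σ` satisfies all clauses, cutting the tree of `σ` as soon as
all clauses have been met yields an element of the strategy semantics. -/
theorem stratSem_nonempty_of_strategy (σ : List (QPos n) → Bool)
    (hσ : ∀ α, ConsistPlay (qArena n k Q C) Prod.fst σ (assignPlay α) → ∀ j, ∃ i, C j (i, α i)) :
    (stratSem (qArena n k Q C) (qTree n k C)).Nonempty := by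
  set A := qArena n k Q C with hA
  set T := STree A Prod.fst σ none with hT
  set S : Set (List (QPos n)) := {w | w ∈ T ∧ ∀ u, u <+: w → u ≠ w → ¬ MeetsAll n k C u} with hS
  have hne : ∀ w ∈ T, w ≠ [] := by
    rintro w hw rfl
    obtain ⟨α, -, m, hm, he⟩ := mem_sTree_start_iff.mp hw
    have := congrArg List.length he
    simp at this
    omega
  have hTpre : ∀ w ∈ T, ∀ u, u <+: w → u ≠ [] → u ∈ T := by
    intro w hw u hu hu0
    obtain ⟨α, hc, m, hm, rfl⟩ := mem_sTree_start_iff.mp hw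
    exact mem_sTree_start_iff.mpr
      ⟨α, hc, u.length, List.length_pos_iff.mpr hu0, eq_playPrefix_of_isPrefix hu⟩
  have hThead : ∀ w ∈ T, w.head? = some none := by
    intro w hw
    obtain ⟨α, hc, m, hm, rfl⟩ := mem_sTree_start_iff.mp hw
    exact head?_playPrefix _ hm
  have hSpre : ∀ w ∈ S, ∀ u, u <+: w → u ≠ [] → u ∈ S := by
    rintro w ⟨hw, hmin⟩ u hu hu0
    refine ⟨hTpre w hw u hu hu0, fun v hv hvu => hmin v (hv.trans hu) ?_⟩
    rintro rfl
    exact hvu (hv.eq_of_length_le hu.length_le)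
  obtain ⟨α₀, hα₀⟩ : ∃ α, ConsistPlay A Prod.fst σ (assignPlay α) := by
    obtain ⟨ρ, hρ, hc, h0⟩ := exists_consistPlay A σ true none
    obtain ⟨α, rfl⟩ := hρ.exists_eq_assignPlay h0
    exact ⟨α, hc⟩
  have hroot : [none] ∈ T := mem_sTree_start_iff.mpr ⟨α₀, hα₀, 1, le_rfl, rfl⟩
  have hrootS : [none] ∈ S := by
    refine ⟨hroot, fun u hu hne' h => not_meetsAll_start n k C (h.mono hu.subset)⟩
  have hS : IsSTree S :=
    ⟨⟨_, hrootS⟩, fun w hw => hne w hw.1, hSpre, none, fun w hw => hThead w hw.1⟩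
  have hlen : ∀ w ∈ S, w.length ≤ n + 2 := by
    rintro w ⟨hw, hmin⟩
    obtain ⟨α, hc, m, hm, rfl⟩ := mem_sTree_start_iff.mp hw
    by_contra hlt
    simp only [length_playPrefix, not_le] at hlt
    refine hmin _ (playPrefix_isPrefix _ hlt.le) (fun h => ?_) (meetsAll_playPrefix (hσ α hc))
    have := congrArg List.length h
    simp at this
    omega
  refine ⟨S, ⟨σ, none, hS, ⟨none, hrootS, hroot⟩, fun w hw => hw.1, fun w hw hnl => ?_⟩,
    (List.finite_length_le (QPos n) (n + 2)).subset hlen, hS, fun w hleaf => ?_⟩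
  · obtain ⟨w', hw', hww', hne'⟩ : ∃ w' ∈ S, w <+: w' ∧ w' ≠ w := by
      by_contra! h
      exact hnl ⟨hw, h⟩
    have hbad : ¬ MeetsAll n k C w := hw'.2 w hww' hne'.symm
    ext x
    constructor
    · rintro ⟨hx, hwx, hxw, hmin⟩
      exact ⟨hx.1, hwx, hxw, fun y hy hwy hyx => hmin y (hSpre x hx y hyx (hne y hy)) hwy hyx⟩
    · rintro ⟨hx, hwx, hxw, hmin⟩
      refine ⟨⟨hx, fun u hu hux => ?_⟩, hwx, hxw, fun y hy => hmin y hy.1⟩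
      rcases List.prefix_or_prefix_of_prefix hu hwx with huw | hwu
      · exact fun h => hbad (h.mono huw.subset)
      · have hu0 : u ≠ [] := by
          rintro rfl
          exact hne w hw.1 (List.prefix_nil.mp hwu)
        rcases hmin u (hTpre x hx u hu hu0) hwu hu with rfl | rfl
        · exact hbad
        · exact absurd rfl hux
  · obtain ⟨hw, hmax⟩ := hleaf
    obtain ⟨α, hc, m, hm, rfl⟩ := mem_sTree_start_iff.mp hw.1
    have hmeet : MeetsAll n k C (playPrefix (assignPlay α) m) := by
      by_contra hbad
      have := hmax (playPrefix (assignPlay α) (m + 1))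
        ⟨mem_sTree_start_iff.mpr ⟨α, hc, m + 1, by omega, rfl⟩, fun u hu hne' h => ?_⟩
        (playPrefix_isPrefix _ (by omega))
      · simpa using congrArg List.length this
      · have hul : u.length ≤ m := by
          by_contra hlt
          refine hne' (hu.eq_of_length_le ?_)
          rw [length_playPrefix]
          omega
        rw [eq_playPrefix_of_isPrefix hu] at h
        exact hbad (h.mono (playPrefix_isPrefix _ hul).subset)
    refine mem_pathSem_qTree_of_meetsAll (isTPath_playPrefix (isPlay_assignPlay α) hm)
      (head?_playPrefix _ hm) ?_ hmeet
    obtain ⟨m, rfl⟩ := Nat.exists_eq_add_of_le' hm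
    have hbad := hw.2 (playPrefix (assignPlay α) m) (playPrefix_isPrefix _ (by omega))
      (fun h => by simpa using congrArg List.length h)
    simp only [MeetsAll, not_forall, not_exists, not_and] at hbad
    obtain ⟨j, hj⟩ := hbad
    obtain ⟨s, hs, hjs⟩ := hmeet j
    rw [playPrefix_succ, List.mem_append, List.mem_singleton] at hs
    rcases hs with hs | rfl
    · exact absurd hjs (hj s hs)
    · exact ⟨j, _, hjs, by simp [playPrefix_succ]⟩

/-- If the strategy semantics is nonempty, some Attacker strategy ensures that all plays from
the initial position satisfy all clauses. -/
theorem exists_strategy_of_stratSem_nonempty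
    (h : (stratSem (qArena n k Q C) (qTree n k C)).Nonempty) :
    ∃ σ : List (QPos n) → Bool,
      ∀ α, ConsistPlay (qArena n k Q C) Prod.fst σ (assignPlay α) → ∀ j, ∃ i, C j (i, α i) := by
  obtain ⟨S, ⟨σ, v, -, ⟨a, haS, haT⟩, hsub, hchild⟩, hfin, hS, hleaf⟩ := h
  obtain rfl : v = none := by
    obtain ⟨w, hw⟩ := hS.exists_isLeafOf hfin
    obtain ⟨-, ρ, hρ, rfl, m, hm, rfl⟩ := hsub hw.1
    obtain ⟨i, -, hi⟩ := mem_playPrefix.mp (meetsAll_of_mem_pathSem_qTree (hleaf _ hw)).1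
    exact hρ.zero_eq_none hi
  refine ⟨σ, fun α hc => ?_⟩
  obtain rfl : a = none := by
    obtain ⟨-, ρ, -, h0, m, hm, he⟩ := haT
    have := (congrArg List.head? he).trans (head?_playPrefix ρ hm)
    simpa [h0] using this
  obtain ⟨w, ⟨hwS, m, hm, rfl⟩, hmax⟩ := Set.exists_max_image
    {w ∈ S | ∃ m, 1 ≤ m ∧ w = playPrefix (assignPlay α) m} List.length
    (hfin.subset fun w hw => hw.1) ⟨_, haS, 1, le_rfl, rfl⟩
  by_cases hl : IsLeafOf S (playPrefix (assignPlay α) m)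
  · exact satisfies_of_meetsAll_playPrefix (meetsAll_of_mem_pathSem_qTree (hleaf _ hl)).2
  exfalso
  have hx : playPrefix (assignPlay α) (m + 1) ∈ childrenOf S (playPrefix (assignPlay α) m) := by
    rw [hchild _ hwS hl]
    refine ⟨mem_sTree_start_iff.mpr ⟨α, hc, m + 1, by omega, rfl⟩,
      playPrefix_isPrefix _ (by omega), fun h => by simpa using congrArg List.length h,
      fun y _ hy hy' => ?_⟩
    have h₁ := hy.length_le
    have h₂ := hy'.length_le
    simp only [length_playPrefix] at h₁ h₂
    rw [eq_playPrefix_of_isPrefix hy']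
    rcases Nat.le_succ_iff.mp h₂ with h | h
    · exact Or.inl (by rw [le_antisymm h h₁])
    · exact Or.inr (by rw [h])
  have := hmax _ ⟨hx.1, m + 1, by omega, rfl⟩
  simp at this

end

/-! ### Strategies for quantified Boolean formulas -/

/-- A quantified Boolean formula is true iff there are choice functions for the existential
variables, each depending only on the earlier variables, that enforce the matrix. -/
theorem qbfTrue_iff_exists_choice (n : ℕ) (Q : Fin n → Bool) (sat : (Fin n → Bool) → Prop) :
    qbfTrue n Q sat ↔ ∃ τ : (Fin n → Bool) → Fin n → Bool,
      (∀ α β i, (∀ j < i, α j = β j) → τ α i = τ β i) ∧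
        ∀ α, (∀ i, Q i = true → α i = τ α i) → sat α := by
  induction n with
  | zero =>
    simp only [qbfTrue]
    constructor
    · intro h
      exact ⟨fun _ i => i.elim0, fun _ _ i => i.elim0, fun α _ => by
        rwa [Subsingleton.elim α]⟩
    · rintro ⟨τ, -, h⟩
      exact h _ fun i => i.elim0
  | succ n ih =>
    have restrict : ∀ (τ : (Fin (n + 1) → Bool) → Fin (n + 1) → Bool) (b : Bool),
        (∀ α β i, (∀ j < i, α j = β j) → τ α i = τ β i) →
        ∀ (α β : Fin n → Bool) (i : Fin n), (∀ j < i, α j = β j) →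
          τ (Fin.cons b α) i.succ = τ (Fin.cons b β) i.succ := by
      refine fun τ b hd α β i h => hd _ _ _ fun j hj => ?_
      cases j using Fin.cases with
      | zero => rfl
      | succ j => exact h j (Fin.succ_lt_succ_iff.mp hj)
    simp only [qbfTrue, ih]
    by_cases hQ : Q 0 = true
    · rw [if_pos hQ]
      constructor
      · rintro ⟨b, τ, hd, hs⟩
        refine ⟨fun α => Fin.cons b (τ (Fin.tail α)), fun α β i h => ?_, fun α h => ?_⟩
        · cases i using Fin.cases with
          | zero => rfl
          | succ i => exact hd _ _ _ fun j hj => h j.succ (Fin.succ_lt_succ_iff.mpr hj)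
        · have h0 : α 0 = b := h 0 hQ
          rw [← Fin.cons_self_tail α, h0]
          exact hs _ fun i hi => h i.succ hi
      · rintro ⟨τ, hd, hs⟩
        let b := τ (fun _ => true) 0
        refine ⟨b, fun α i => τ (Fin.cons b α) i.succ, restrict τ b hd, fun α h => hs _ fun i hi => ?_⟩
        cases i using Fin.cases with
        | zero => exact hd _ _ _ fun j hj => absurd hj (Fin.not_lt_zero j)
        | succ i => exact h i hi
    · rw [if_neg hQ]
      constructor
      · intro h
        choose τ hd hs using h
        refine ⟨fun α => Fin.cons true (τ (α 0) (Fin.tail α)), fun α β i h => ?_, fun α h => ?_⟩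
        · cases i using Fin.cases with
          | zero => rfl
          | succ i =>
            have h0 : α 0 = β 0 := h 0 (Fin.succ_pos i)
            simp only [Fin.cons_succ, h0]
            exact hd _ _ _ _ fun j hj => h j.succ (Fin.succ_lt_succ_iff.mpr hj)
        · rw [← Fin.cons_self_tail α]
          exact hs _ _ fun i hi => h i.succ hi
      · rintro ⟨τ, hd, hs⟩ b
        refine ⟨fun α i => τ (Fin.cons b α) i.succ, restrict τ b hd, fun α h => hs _ fun i hi => ?_⟩
        cases i using Fin.cases with
        | zero => exact absurd hi hQ
        | succ i => exact h i hi

-- Statement 11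
theorem qbf_iff_stratSem_nonempty (n k : ℕ) (Q : Fin (n + 1) → Bool)
    (C : Fin (k + 1) → Fin (n + 1) × Bool → Prop) :
    qbfTrue (n + 1) Q (fun α => ∀ j : Fin (k + 1), ∃ i : Fin (n + 1), C j (i, α i)) ↔
    (stratSem (qArena n k Q C) (qTree n k C)).Nonempty := by
  rw [qbfTrue_iff_exists_choice]
  constructor
  · rintro ⟨τ, hd, hs⟩
    refine stratSem_nonempty_of_strategy
      (fun w => if h : w.length - 1 < n + 1 then
        τ (fun j => ((w.getD (j + 1) none).map Prod.snd).getD false) ⟨w.length - 1, h⟩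
        else false)
      fun α hc => hs α fun i hi => ?_
    rw [consistPlay_assignPlay_iff.mp hc i hi]
    simp only [length_playPrefix, Nat.add_sub_cancel, i.isLt, dif_pos]
    refine hd _ _ _ fun j hj => ?_
    have hj' : (j : ℕ) + 1 < (playPrefix (assignPlay α) (i + 1)).length := by
      rw [length_playPrefix]
      exact Nat.succ_lt_succ hj
    rw [List.getD_eq_getElem _ _ hj', getElem_playPrefix, assignPlay_succ]
    rfl
  · intro h
    obtain ⟨σ, hσ⟩ := exists_strategy_of_stratSem_nonempty h
    refine ⟨fun α i => σ (playPrefix (assignPlay α) (i + 1)), fun α β i h => congrArg σ ?_,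
      fun α h => hσ α (consistPlay_assignPlay_iff.mpr h)⟩
    refine List.map_congr_left fun l hl => ?_
    cases l with
    | zero => rfl
    | succ l =>
      have hl' : l < i := Nat.lt_of_succ_lt_succ (List.mem_range.mp hl)
      have hα := assignPlay_succ α ⟨l, by omega⟩
      have hβ := assignPlay_succ β ⟨l, by omega⟩
      exact hα.trans (Eq.trans (by rw [h _ hl']) hβ.symm)
end

section
/- Correctness of the reduction from SAT to the Non-Emptiness problem for the path semantics: let ψ = C₁ ∧ … ∧ C_k be a Boolean formula in conjunctive normal form over variables x₁,…,x_n. Build the transition system T_ψ over Prop = {Start, p₁,…,p_k} with states {Start} ∪ {v_i, ¬v_i : 1 ≤ i ≤ n}, transitions from Start to v₁ and to ¬v₁, from each of v_i, ¬v_i to each of v_{i+1}, ¬v_{i+1} (for 1 ≤ i < n), and self-loops on v_n and ¬v_n; the valuation is λ(Start) = {Start}, λ(v_i) = {p_j : x_i ∈ C_j} and λ(¬v_i) = {p_j : ¬x_i ∈ C_j}. Then ψ is satisfiable if and only if the path semantics [[SAND(Start, AND(p₁,…,p_k))]] over T_ψ is nonempty. -/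
variable {Pos Act₁ Act₂ Prp : Type*}

/-- The transition relation of the reduction transition system `T_ψ`: from `Start` to
`v₁` and `¬v₁`, from each of `v_i, ¬v_i` to each of `v_{i+1}, ¬v_{i+1}`, and self-loops
on `v_n` and `¬v_n`. -/
def sStep (n : ℕ) : QPos n → QPos n → Prop
  | none, some p => (p.1 : ℕ) = 0
  | some p, some p' => ((p'.1 : ℕ) = (p.1 : ℕ) + 1) ∨ ((p.1 : ℕ) = n ∧ p' = p)
  | _, none => False

/-- The reduction transition system `T_ψ`. -/
def sTSys (n k : ℕ) (C : Fin (k + 1) → Fin (n + 1) × Bool → Prop) :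
    TSys (QPos n) (Option (Fin (k + 1))) :=
  ⟨sStep n, qVal n k C⟩

/-- Every word in the semantics of a conjunction of leaves is a path that visits each of the
leaf sets. -/
theorem isTPath_and_visits_of_mem_pathSem_foldr_and {σ π : Type*} (T : TSys σ π) (G : Set σ)
    (L : List (Set σ)) {w : List σ}
    (hw : w ∈ pathSem T ((L.map ATree.leaf).foldr ATree.and (ATree.leaf G))) :
    IsTPath T w ∧ ∀ F ∈ G :: L, ∃ s ∈ w, s ∈ F := by
  induction L generalizing w with
  | nil =>
    obtain ⟨hp, s, hs, hl⟩ := hw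
    refine ⟨hp, fun F hF => ?_⟩
    rw [List.mem_singleton] at hF
    exact ⟨s, List.mem_of_getLast? hl, hF ▸ hs⟩
  | cons F₀ L ih =>
    rcases hw with ⟨⟨hp, s, hs, hl⟩, q, hq, hqw⟩ | ⟨hq, p, ⟨hp, s, hs, hl⟩, hpw⟩
    · refine ⟨hp, fun F hF => ?_⟩
      by_cases h : F = F₀
      · exact ⟨s, List.mem_of_getLast? hl, h ▸ hs⟩
      · obtain ⟨t, ht, htF⟩ := (ih hq).2 F (by simp_all)
        exact ⟨t, hqw.subset ht, htF⟩
    · refine ⟨(ih hq).1, fun F hF => ?_⟩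
      by_cases h : F = F₀
      · exact ⟨s, hpw.subset (List.mem_of_getLast? hl), h ▸ hs⟩
      · exact (ih hq).2 F (by simp_all)

/-- A path that visits a set has a prefix in the semantics of the corresponding leaf. -/
theorem exists_prefix_mem_pathSem_leaf {σ π : Type*} (T : TSys σ π) (F : Set σ) {w : List σ}
    (hw : IsTPath T w) (h : ∃ s ∈ w, s ∈ F) :
    ∃ w' ∈ pathSem T (ATree.leaf F), w' <+: w := by
  obtain ⟨s, hs, hF⟩ := h
  obtain ⟨u, v, rfl⟩ := List.append_of_mem hs
  have hpre : u ++ [s] <+: u ++ s :: v := ⟨v, by simp⟩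
  exact ⟨u ++ [s], ⟨⟨by simp, hw.2.prefix hpre⟩, s, hF, by simp⟩, hpre⟩

/-- A path that visits each of the given sets has a prefix in the semantics of the conjunction
of the corresponding leaves. -/
theorem exists_prefix_mem_pathSem_foldr_and {σ π : Type*} (T : TSys σ π) (G : Set σ)
    (L : List (Set σ)) {w : List σ} (hw : IsTPath T w)
    (h : ∀ F ∈ G :: L, ∃ s ∈ w, s ∈ F) :
    ∃ w' ∈ pathSem T ((L.map ATree.leaf).foldr ATree.and (ATree.leaf G)), w' <+: w := by
  induction L with
  | nil => exact exists_prefix_mem_pathSem_leaf T G hw (h G (by simp))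
  | cons F₀ L ih =>
    obtain ⟨q, hq, hqw⟩ := ih fun F hF => h F (by simp_all; tauto)
    obtain ⟨p, hp, hpw⟩ := exists_prefix_mem_pathSem_leaf T F₀ hw (h F₀ (by simp))
    rcases List.prefix_or_prefix_of_prefix hpw hqw with hpq | hqp
    · exact ⟨q, Or.inr ⟨hq, p, hp, hpq⟩, hqw⟩
    · exact ⟨p, Or.inl ⟨hp, q, hq, hqp⟩, hpw⟩

/-- The depth of a state of the reduction transition system. -/
def sLevel (n : ℕ) : QPos n → ℕ
  | none => 0
  | some p => p.1 + 1

/-- A path of the reduction transition system visits at most one state of each depth. -/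
theorem eq_of_mem_chain_of_sLevel_eq (n : ℕ) {w : List (QPos n)} (hw : w.IsChain (sStep n))
    {x y : QPos n} (hx : x ∈ w) (hy : y ∈ w) (hxy : sLevel n x = sLevel n y) : x = y := by
  let R : QPos n → QPos n → Prop := fun a b => a = b ∨ sLevel n a < sLevel n b
  have : IsTrans (QPos n) R := ⟨by
    rintro a b c (rfl | hab) (rfl | hbc)
    · exact Or.inl rfl
    · exact Or.inr hbc
    · exact Or.inr hab
    · exact Or.inr (hab.trans hbc)⟩
  have hstep : ∀ a b, sStep n a b → R a b := by
    rintro (_ | a) (_ | b) h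
    · exact h.elim
    · exact Or.inr (Nat.succ_pos _)
    · exact h.elim
    · rcases h with h | ⟨-, rfl⟩
      · right
        simp only [sLevel]
        omega
      · exact Or.inl rfl
  have hpair : w.Pairwise fun a b => sLevel n a = sLevel n b → a = b :=
    (hw.imp hstep).pairwise.imp fun h he => h.resolve_right he.not_lt
  have hsymm : Std.Symm fun a b : QPos n => sLevel n a = sLevel n b → a = b :=
    ⟨fun _ _ h he => (h he.symm).symm⟩
  exact hpair.forall_of_forall (fun _ _ _ => rfl) hx hy hxy

/-- The path through the reduction transition system that follows an assignment. -/
def assignPath (n : ℕ) (α : Fin (n + 1) → Bool) : List (QPos n) :=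
  none :: List.ofFn fun i => some (i, α i)

theorem isChain_assignPath (n : ℕ) (α : Fin (n + 1) → Bool) :
    (assignPath n α).IsChain (sStep n) := by
  rw [List.isChain_iff_getElem]
  rintro (_ | i) hi
  · simp [assignPath, sStep]
  · simp [assignPath, sStep, -List.ofFn_succ]

/-- The clause sets of the reduction, the last clause excluded. -/
def clauseSets (n k : ℕ) (C : Fin (k + 1) → Fin (n + 1) × Bool → Prop) :
    List (Set (QPos n)) :=
  List.ofFn fun j : Fin k => {v | some j.castSucc ∈ qVal n k C v}

theorem qTree_eq (n k : ℕ) (C : Fin (k + 1) → Fin (n + 1) × Bool → Prop) :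
    qTree n k C = ATree.sand (ATree.leaf {v | none ∈ qVal n k C v})
      (((clauseSets n k C).map ATree.leaf).foldr ATree.and
        (ATree.leaf {v | some (Fin.last k) ∈ qVal n k C v})) := by
  simp only [qTree, clauseSets, List.map_ofFn]
  rfl

theorem forall_mem_clauseSets_iff (n k : ℕ) (C : Fin (k + 1) → Fin (n + 1) × Bool → Prop)
    (P : Set (QPos n) → Prop) :
    (∀ F ∈ {v | some (Fin.last k) ∈ qVal n k C v} :: clauseSets n k C, P F) ↔
      ∀ j, P {v | some j ∈ qVal n k C v} := by
  rw [List.forall_mem_cons, Fin.forall_fin_succ', and_comm]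
  simp [clauseSets, List.mem_ofFn]

-- Statement 12
theorem sat_iff_pathSem_nonempty (n k : ℕ)
    (C : Fin (k + 1) → Fin (n + 1) × Bool → Prop) :
    (∃ α : Fin (n + 1) → Bool, ∀ j : Fin (k + 1), ∃ i : Fin (n + 1), C j (i, α i)) ↔
    (pathSem (sTSys n k C) (qTree n k C)).Nonempty := by
  rw [qTree_eq]
  constructor
  · rintro ⟨α, hα⟩
    obtain ⟨q, hq, hpre⟩ := exists_prefix_mem_pathSem_foldr_and (sTSys n k C)
      {v | some (Fin.last k) ∈ qVal n k C v} (clauseSets n k C) (w := assignPath n α)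
      ⟨List.cons_ne_nil _ _, isChain_assignPath n α⟩
      ((forall_mem_clauseSets_iff n k C _).2 fun j => by
        obtain ⟨i, hi⟩ := hα j
        exact ⟨some (i, α i), List.mem_cons_of_mem _ (List.mem_ofFn.2 ⟨i, rfl⟩), j, rfl, hi⟩)
    have hne := (isTPath_and_visits_of_mem_pathSem_foldr_and _ _ _ hq).1.1
    refine ⟨_, [none], ⟨⟨by simp, List.isChain_singleton _⟩, none, rfl, rfl⟩, q, hq, ?_, rfl⟩
    obtain ⟨a, l, rfl⟩ := List.exists_cons_of_ne_nil hne
    obtain ⟨rfl, -⟩ := List.cons_prefix_cons.1 hpre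
    rfl
  · rintro ⟨_, _, -, q, hq, -, -⟩
    obtain ⟨⟨-, hchain⟩, hvis⟩ := isTPath_and_visits_of_mem_pathSem_foldr_and _ _ _ hq
    rw [forall_mem_clauseSets_iff n k C fun F => ∃ s ∈ q, s ∈ F] at hvis
    classical
    refine ⟨fun i => decide (some (i, true) ∈ q), fun j => ?_⟩
    obtain ⟨_ | ⟨i, b⟩, hs, hF⟩ := hvis j
    · simp [qVal] at hF
    · obtain ⟨j', hj, hC⟩ := hF
      obtain rfl := Option.some.inj hj
      refine ⟨i, ?_⟩
      convert hC
      cases b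
      · refine decide_eq_false fun ht => ?_
        simpa using eq_of_mem_chain_of_sLevel_eq n hchain hs ht rfl
      · exact decide_eq_true hs
end
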